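/- Suppose η ≥ η₀ = max(n, (32/γ²)·log(256/γ²)). Then for every t such that F(w_s) > 1/(8η) for all s ≤ t, one has |w̃_t| ≤ η. -/

import Mathlib

open scoped InnerProductSpace BigOperators
open Finset

/-- Logistic loss `F(w) = (1/n) ∑ᵢ log(1 + exp(−⟨w, xᵢ⟩))`. -/
noncomputable def logisticLoss (n : ℕ) (x : Fin n → EuclideanSpace ℝ (Fin 2))
    (w : EuclideanSpace ℝ (Fin 2)) : ℝ :=
  (n : ℝ)⁻¹ * ∑ i, Real.log (1 + Real.exp (-⟪w, x i⟫_ℝ))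

/-- Gradient potential `G(w) = (1/n) ∑ᵢ 1/(exp(⟨w, xᵢ⟩) + 1)`. -/
noncomputable def gradPotential (n : ℕ) (x : Fin n → EuclideanSpace ℝ (Fin 2))
    (w : EuclideanSpace ℝ (Fin 2)) : ℝ :=
  (n : ℝ)⁻¹ * ∑ i, (Real.exp ⟪w, x i⟫_ℝ + 1)⁻¹

/-- Gradient descent iterates: `w₀ = 0`, `w_{t+1} = w_t − η ∇F(w_t)`
(the gradient of the logistic loss is written in closed form). -/
noncomputable def gdIter (n : ℕ) (x : Fin n → EuclideanSpace ℝ (Fin 2)) (η : ℝ) :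
    ℕ → EuclideanSpace ℝ (Fin 2)
  | 0 => 0
  | t + 1 => gdIter n x η t
      + (η / n) • ∑ i, (Real.exp ⟪gdIter n x η t, x i⟫_ℝ + 1)⁻¹ • x i

/-- `γ` is the maximum margin of the dataset `x`:
it is the greatest `m` such that some unit vector `w` satisfies `⟨w, xᵢ⟩ ≥ m` for all `i`. -/
def isMaxMargin (n : ℕ) (x : Fin n → EuclideanSpace ℝ (Fin 2)) (γ : ℝ) : Prop :=
  IsGreatest {m : ℝ | ∃ w : EuclideanSpace ℝ (Fin 2), ‖w‖ = 1 ∧ ∀ i, m ≤ ⟪w, x i⟫_ℝ} γ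

/-- An orthonormal pair in the plane resolves every inner product into two coordinates. -/
theorem inner_eq_add_of_orthonormal_pair {u v : EuclideanSpace ℝ (Fin 2)} (hu : ‖u‖ = 1)
    (hv : ‖v‖ = 1) (hvu : ⟪v, u⟫_ℝ = 0) (w y : EuclideanSpace ℝ (Fin 2)) :
    ⟪w, y⟫_ℝ = ⟪w, u⟫_ℝ * ⟪u, y⟫_ℝ + ⟪w, v⟫_ℝ * ⟪v, y⟫_ℝ := by
  have hon : Orthonormal ℝ ![u, v] := by
    rw [orthonormal_vecCons_iff]
    refine ⟨hu, ?_, ?_⟩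
    · intro i
      simpa [real_inner_comm] using hvu
    · simpa [orthonormal_vecCons_iff] using hv
  let b := basisOfOrthonormalOfCardEqFinrank hon (by simp)
  have hb : ⇑b = ![u, v] := coe_basisOfOrthonormalOfCardEqFinrank hon (by simp)
  have h := (b.toOrthonormalBasis (by rw [hb]; exact hon)).sum_inner_mul_inner w y
  rw [← h, Fin.sum_univ_two]
  simp [hb]

theorem inv_exp_add_one_le_exp_neg (z : ℝ) : (Real.exp z + 1)⁻¹ ≤ Real.exp (-z) := by
  rw [Real.exp_neg]
  exact inv_anti₀ (Real.exp_pos z) (by linarith)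

theorem inv_exp_add_one_le_one (z : ℝ) : (Real.exp z + 1)⁻¹ ≤ 1 :=
  inv_le_one_of_one_le₀ (by linarith [Real.exp_pos z])

theorem inv_exp_add_one_pos (z : ℝ) : 0 < (Real.exp z + 1)⁻¹ :=
  inv_pos.2 (by linarith [Real.exp_pos z])

/-- One gradient step moves a nonnegative transversal coordinate up by at most an exponentially
small amount, and moves it below zero by at most the step size times the transversal size of the
data. -/
theorem transversal_step_of_nonneg {n : ℕ} (hn : 0 < n) {a b : Fin n → ℝ} {γ κ η α β : ℝ}
    (ha : ∀ i, γ ≤ a i) (hb : ∀ i, |b i| ≤ κ) (hκ : κ ≤ 1) (hη : 0 < η) (hα : 0 ≤ α)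
    (hβ : 0 ≤ β) :
    -(η * κ) ≤ β + η / n * ∑ i, (Real.exp (α * a i + β * b i) + 1)⁻¹ * b i ∧
      β + η / n * ∑ i, (Real.exp (α * a i + β * b i) + 1)⁻¹ * b i
        ≤ β + η * Real.exp (-(α * γ)) := by
  have hn' : (0 : ℝ) < n := by exact_mod_cast hn
  have lower : ∀ i, -κ ≤ (Real.exp (α * a i + β * b i) + 1)⁻¹ * b i := by
    intro i
    have h1 := inv_exp_add_one_le_one (α * a i + β * b i)
    have h0 := inv_exp_add_one_pos (α * a i + β * b i)
    have h2 := abs_le.1 (hb i)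
    have h3 : 0 ≤ κ := (abs_nonneg _).trans (hb i)
    nlinarith
  have upper : ∀ i, (Real.exp (α * a i + β * b i) + 1)⁻¹ * b i ≤ Real.exp (-(α * γ)) := by
    intro i
    have h0 := inv_exp_add_one_pos (α * a i + β * b i)
    have h1 := inv_exp_add_one_le_exp_neg (α * a i + β * b i)
    have he := Real.exp_pos (-(α * γ))
    rcases le_total (b i) 0 with h | h
    · nlinarith
    · have h2 : b i ≤ 1 := (le_abs_self _).trans ((hb i).trans hκ)
      have h3 : Real.exp (-(α * a i + β * b i)) ≤ Real.exp (-(α * γ)) := by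
        apply Real.exp_le_exp.2
        nlinarith [mul_nonneg hβ h, mul_le_mul_of_nonneg_left (ha i) hα]
      nlinarith
  have hlow := Finset.sum_le_sum fun i (_ : i ∈ Finset.univ) => lower i
  have hup := Finset.sum_le_sum fun i (_ : i ∈ Finset.univ) => upper i
  simp only [Finset.sum_const, Finset.card_univ, Fintype.card_fin, nsmul_eq_mul] at hlow hup
  have hpos : 0 ≤ η / n := by positivity
  have h1 := mul_le_mul_of_nonneg_left hlow hpos
  have h2 := mul_le_mul_of_nonneg_left hup hpos
  have e1 : η / n * (n * -κ) = -(η * κ) := by field_simp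
  have e2 : η / n * (n * Real.exp (-(α * γ))) = η * Real.exp (-(α * γ)) := by field_simp
  constructor <;> linarith

theorem abs_transversal_step_le {n : ℕ} (hn : 0 < n) {a b : Fin n → ℝ} {γ κ η α β D : ℝ}
    (ha : ∀ i, γ ≤ a i) (hb : ∀ i, |b i| ≤ κ) (hκ : κ ≤ 1) (hη : 0 < η) (hα : 0 ≤ α)
    (hD : 0 ≤ D) (hβ : |β| ≤ η * κ + D) :
    |β + η / n * ∑ i, (Real.exp (α * a i + β * b i) + 1)⁻¹ * b i|
      ≤ η * κ + (D + η * Real.exp (-(α * γ))) := by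
  have he := mul_pos hη (Real.exp_pos (-(α * γ)))
  rw [abs_le] at hβ ⊢
  rcases le_total 0 β with h | h
  · have := transversal_step_of_nonneg hn ha hb hκ hη hα h
    constructor <;> linarith [this.1, this.2]
  · have := transversal_step_of_nonneg (b := fun i => -b i) hn ha
      (fun i => by simpa using hb i) hκ hη hα (neg_nonneg.2 h)
    simp only [neg_mul, mul_neg, neg_neg, Finset.sum_neg_distrib] at this
    constructor <;> linarith [this.1, this.2]

/-- A loss above `1 / (8η)` forces a gradient potential of at least `1 / (16η)` when `n ≤ η`. -/
theorem gradPotential_ge_of_lt_logisticLoss {n : ℕ} (hn : 0 < n)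
    (x : Fin n → EuclideanSpace ℝ (Fin 2)) {η : ℝ} (hη : (n : ℝ) ≤ η)
    (w : EuclideanSpace ℝ (Fin 2)) (h : 1 / (8 * η) < logisticLoss n x w) :
    1 / (16 * η) ≤ gradPotential n x w := by
  have hn' : (0 : ℝ) < n := by exact_mod_cast hn
  have hη0 : 0 < η := hn'.trans_le hη
  by_cases hz : ∀ i, 0 ≤ ⟪w, x i⟫_ℝ
  · have key : logisticLoss n x w ≤ 2 * gradPotential n x w := by
      have hsum : ∑ i, Real.log (1 + Real.exp (-⟪w, x i⟫_ℝ))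
          ≤ 2 * ∑ i, (Real.exp ⟪w, x i⟫_ℝ + 1)⁻¹ := by
        rw [Finset.mul_sum]
        refine Finset.sum_le_sum fun i _ => ?_
        have h1 := Real.log_le_sub_one_of_pos (x := 1 + Real.exp (-⟪w, x i⟫_ℝ)) (by positivity)
        have h2 : Real.exp (-⟪w, x i⟫_ℝ) ≤ 2 * (Real.exp ⟪w, x i⟫_ℝ + 1)⁻¹ := by
          have h3 := Real.one_le_exp (hz i)
          rw [Real.exp_neg, ← div_eq_mul_inv, inv_eq_one_div,
            div_le_div_iff₀ (by positivity) (by positivity)]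
          linarith
        linarith
      unfold logisticLoss gradPotential
      have := mul_le_mul_of_nonneg_left hsum (inv_nonneg.2 hn'.le)
      linarith
    have e : 1 / (16 * η) = 1 / (8 * η) / 2 := by
      field_simp
      norm_num
    rw [e]
    linarith
  · push Not at hz
    obtain ⟨i, hi⟩ := hz
    have h1 : (1 / 2 : ℝ) ≤ (Real.exp ⟪w, x i⟫_ℝ + 1)⁻¹ := by
      have := Real.exp_le_one_iff.2 hi.le
      rw [← one_div]
      exact one_div_le_one_div_of_le (by positivity) (by linarith)
    have h2 := Finset.single_le_sum (f := fun i => (Real.exp ⟪w, x i⟫_ℝ + 1)⁻¹)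
      (fun j _ => (inv_exp_add_one_pos ⟪w, x j⟫_ℝ).le) (Finset.mem_univ i)
    unfold gradPotential
    calc 1 / (16 * η) ≤ (n : ℝ)⁻¹ * (1 / 2) := by
          rw [inv_mul_eq_div, div_div, ← one_div_mul_one_div, ← one_div_mul_one_div,
            ← mul_comm (1 / η)]
          have := one_div_le_one_div_of_le hn' hη
          have := one_div_pos.2 hη0
          linarith
      _ ≤ _ := mul_le_mul_of_nonneg_left (h1.trans h2) (by positivity)

theorem inner_gdIter_succ {n : ℕ} (x : Fin n → EuclideanSpace ℝ (Fin 2)) (η : ℝ) (t : ℕ)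
    (u : EuclideanSpace ℝ (Fin 2)) :
    ⟪gdIter n x η (t + 1), u⟫_ℝ = ⟪gdIter n x η t, u⟫_ℝ
      + η / n * ∑ i, (Real.exp ⟪gdIter n x η t, x i⟫_ℝ + 1)⁻¹ * ⟪u, x i⟫_ℝ := by
  rw [gdIter, inner_add_left, real_inner_smul_left, sum_inner]
  simp only [real_inner_comm u, real_inner_smul_right]

/-- Each gradient step increases the coordinate along a separating direction. -/
theorem inner_gdIter_succ_ge {n : ℕ} (x : Fin n → EuclideanSpace ℝ (Fin 2)) {η γ : ℝ}
    (hη : 0 ≤ η) {u : EuclideanSpace ℝ (Fin 2)} (hu : ∀ i, γ ≤ ⟪u, x i⟫_ℝ) (t : ℕ) :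
    ⟪gdIter n x η t, u⟫_ℝ + η * γ * gradPotential n x (gdIter n x η t)
      ≤ ⟪gdIter n x η (t + 1), u⟫_ℝ := by
  rw [inner_gdIter_succ, gradPotential]
  have hsum : γ * ∑ i, (Real.exp ⟪gdIter n x η t, x i⟫_ℝ + 1)⁻¹
      ≤ ∑ i, (Real.exp ⟪gdIter n x η t, x i⟫_ℝ + 1)⁻¹ * ⟪u, x i⟫_ℝ := by
    rw [Finset.mul_sum]
    refine Finset.sum_le_sum fun i _ => ?_
    rw [mul_comm]
    exact mul_le_mul_of_nonneg_left (hu i) (inv_exp_add_one_pos _).le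
  have := mul_le_mul_of_nonneg_left hsum (by positivity : 0 ≤ η / n)
  rw [div_eq_mul_inv] at this ⊢
  linarith

theorem gradPotential_zero {n : ℕ} (hn : 0 < n) (x : Fin n → EuclideanSpace ℝ (Fin 2)) :
    gradPotential n x 0 = 1 / 2 := by
  have hn' : (n : ℝ) ≠ 0 := by exact_mod_cast hn.ne'
  simp only [gradPotential, inner_zero_left, Real.exp_zero, Finset.sum_const, Finset.card_univ,
    Fintype.card_fin, nsmul_eq_mul]
  field_simp
  norm_num

/-- While the loss stays above `1 / (8η)`, the coordinate along a separating direction grows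
linearly. -/
theorem inner_gdIter_succ_ge_linear {n : ℕ} (hn : 0 < n) (x : Fin n → EuclideanSpace ℝ (Fin 2))
    {η γ : ℝ} (hη : (n : ℝ) ≤ η) (hγ : 0 ≤ γ) {u : EuclideanSpace ℝ (Fin 2)}
    (hu : ∀ i, γ ≤ ⟪u, x i⟫_ℝ) (t : ℕ)
    (hloss : ∀ s ≤ t, 1 / (8 * η) < logisticLoss n x (gdIter n x η s)) :
    γ * η / 2 + t * (γ / 16) ≤ ⟪gdIter n x η (t + 1), u⟫_ℝ := by
  have hη0 : 0 < η := lt_of_lt_of_le (by exact_mod_cast hn) hη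
  induction t with
  | zero =>
    have h := inner_gdIter_succ_ge x hη0.le hu 0
    simp only [gdIter, gradPotential_zero hn, inner_zero_left] at h ⊢
    push_cast
    linarith
  | succ t ih =>
    have h := inner_gdIter_succ_ge x hη0.le hu (t + 1)
    have hG := mul_le_mul_of_nonneg_left
      (gradPotential_ge_of_lt_logisticLoss hn x hη _ (hloss (t + 1) le_rfl))
      (mul_nonneg hη0.le hγ)
    have e : η * γ * (1 / (16 * η)) = γ / 16 := by field_simp
    have := ih fun s hs => hloss s (by omega)
    push_cast
    linarith

/-- While the loss stays above `1 / (8η)`, the coordinate transversal to a separating direction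
drifts by at most a geometric sum. -/
theorem abs_inner_gdIter_succ_le {n : ℕ} (hn : 0 < n) (x : Fin n → EuclideanSpace ℝ (Fin 2))
    {η γ κ : ℝ} (hη : (n : ℝ) ≤ η) (hγ : 0 ≤ γ) {u v : EuclideanSpace ℝ (Fin 2)}
    (hu1 : ‖u‖ = 1) (hv1 : ‖v‖ = 1) (hvu : ⟪v, u⟫_ℝ = 0)
    (hu : ∀ i, γ ≤ ⟪u, x i⟫_ℝ) (hv : ∀ i, |⟪v, x i⟫_ℝ| ≤ κ) (hκ : κ ≤ 1) (t : ℕ)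
    (hloss : ∀ s ≤ t, 1 / (8 * η) < logisticLoss n x (gdIter n x η s)) :
    |⟪gdIter n x η (t + 1), v⟫_ℝ| ≤ η * κ
      + η * (Real.exp (-(γ ^ 2 * η / 2)) * ∑ s ∈ Finset.range t, Real.exp (-(γ ^ 2 / 16)) ^ s) := by
  have hη0 : 0 < η := lt_of_lt_of_le (by exact_mod_cast hn) hη
  induction t with
  | zero =>
    have hκ0 : 0 ≤ κ := (abs_nonneg _).trans (hv ⟨0, hn⟩)
    have h1 := transversal_step_of_nonneg hn hu hv hκ hη0 le_rfl (le_refl (0 : ℝ))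
    have h2 := transversal_step_of_nonneg (b := fun i => -⟪v, x i⟫_ℝ) hn hu
      (fun i => by simpa using hv i) hκ hη0 le_rfl (le_refl (0 : ℝ))
    rw [inner_gdIter_succ]
    simp only [zero_mul, zero_add, mul_neg, Finset.sum_neg_distrib] at h1 h2
    simp only [gdIter, inner_zero_left, zero_add, Finset.range_zero, Finset.sum_empty, mul_zero,
      add_zero]
    rw [abs_le]
    norm_num at h1 h2 ⊢
    constructor <;> linarith [h1.1, h2.1]
  | succ t ih =>
    have hα := inner_gdIter_succ_ge_linear hn x hη hγ hu t fun s hs => hloss s (by omega)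
    have hα0 : 0 ≤ ⟪gdIter n x η (t + 1), u⟫_ℝ := le_trans (by positivity) hα
    have hstep := abs_transversal_step_le hn hu hv hκ hη0 hα0 (by positivity)
      (ih fun s hs => hloss s (by omega))
    have hexp : Real.exp (-(⟪gdIter n x η (t + 1), u⟫_ℝ * γ))
        ≤ Real.exp (-(γ ^ 2 * η / 2)) * Real.exp (-(γ ^ 2 / 16)) ^ t := by
      rw [← Real.exp_nat_mul, ← Real.exp_add]
      apply Real.exp_le_exp.2
      linarith [mul_le_mul_of_nonneg_right hα hγ]
    rw [inner_gdIter_succ, Finset.sum_range_succ]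
    simp only [inner_eq_add_of_orthonormal_pair hu1 hv1 hvu (gdIter n x η (t + 1)) (x _)]
    linarith [mul_le_mul_of_nonneg_left hexp hη0.le]

theorem geom_sum_exp_neg_le {u : ℝ} (hu : 0 < u) (t : ℕ) :
    ∑ s ∈ Finset.range t, Real.exp (-u) ^ s ≤ (1 + u) / u := by
  have hE : Real.exp (-u) ≤ 1 / (1 + u) := by
    rw [Real.exp_neg, ← one_div]
    exact one_div_le_one_div_of_le (by positivity) (by linarith [Real.add_one_le_exp u])
  have h1 : u / (1 + u) ≤ 1 - Real.exp (-u) := by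
    have : u / (1 + u) = 1 - 1 / (1 + u) := by
      field_simp
      ring
    linarith
  have h0 : 0 < u / (1 + u) := by positivity
  have hg := geom_sum_mul_neg (Real.exp (-u)) t
  have hS : 0 ≤ ∑ s ∈ Finset.range t, Real.exp (-u) ^ s := by positivity
  have hp : 0 ≤ Real.exp (-u) ^ t := by positivity
  have h2 := mul_le_mul_of_nonneg_left h1 hS
  rw [← inv_div, ← one_div, le_div_iff₀ h0]
  linarith

theorem exp_neg_le_of_log_le {γ η : ℝ} (hγ0 : 0 < γ) (hγ1 : γ < 1)
    (hη : 32 / γ ^ 2 * Real.log (256 / γ ^ 2) ≤ η) :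
    Real.exp (-(γ ^ 2 * η / 2)) ≤ (γ ^ 2 / 256) ^ 2 := by
  have hlog : 0 ≤ Real.log (256 / γ ^ 2) := by
    apply Real.log_nonneg
    rw [le_div_iff₀ (by positivity)]
    nlinarith
  have h1 : 32 * Real.log (256 / γ ^ 2) ≤ γ ^ 2 * η := by
    have := mul_le_mul_of_nonneg_left hη (by positivity : 0 ≤ γ ^ 2)
    have e : γ ^ 2 * (32 / γ ^ 2 * Real.log (256 / γ ^ 2)) = 32 * Real.log (256 / γ ^ 2) := by
      field_simp
    linarith
  have h2 : Real.log ((γ ^ 2 / 256) ^ 2) = -(2 * Real.log (256 / γ ^ 2)) := by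
    rw [Real.log_pow, ← inv_div, Real.log_inv]
    push_cast
    ring
  rw [← Real.le_log_iff_exp_le (by positivity), h2]
  linarith

theorem stmt_8 (n : ℕ) (hn : 0 < n) (x : Fin n → EuclideanSpace ℝ (Fin 2))
    (hx : ∀ i, ‖x i‖ ≤ 1) (γ : ℝ) (hγ0 : 0 < γ) (hγ1 : γ < 1)
    (hmm : isMaxMargin n x γ)
    (wst : EuclideanSpace ℝ (Fin 2)) (hws : ‖wst‖ = 1) (hsep : ∀ i, γ ≤ ⟪wst, x i⟫_ℝ)
    (vst : EuclideanSpace ℝ (Fin 2)) (hvs : ‖vst‖ = 1) (hvw : ⟪vst, wst⟫_ℝ = 0)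
    (η : ℝ) (hη : max (n : ℝ) (32 / γ ^ 2 * Real.log (256 / γ ^ 2)) ≤ η)
    (t : ℕ) (hloss : ∀ s : ℕ, s ≤ t → 1 / (8 * η) < logisticLoss n x (gdIter n x η s)) :
    |⟪gdIter n x η t, vst⟫_ℝ| ≤ η := by
  have hηn : (n : ℝ) ≤ η := (le_max_left _ _).trans hη
  have hη0 : 0 < η := lt_of_lt_of_le (by exact_mod_cast hn) hηn
  rcases t with _ | t
  · simpa [gdIter] using hη0.le
  have hv : ∀ i, |⟪vst, x i⟫_ℝ| ≤ 1 - γ ^ 2 / 2 := by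
    intro i
    have h1 := inner_eq_add_of_orthonormal_pair hws hvs hvw (x i) (x i)
    rw [real_inner_self_eq_norm_sq, real_inner_comm wst, real_inner_comm vst] at h1
    have h2 := hx i
    have h3 := hsep i
    have h4 := norm_nonneg (x i)
    refine abs_le_of_sq_le_sq ?_ (by nlinarith)
    nlinarith [sq_nonneg (γ ^ 2)]
  have hβ := abs_inner_gdIter_succ_le hn x hηn hγ0.le hws hvs hvw hsep hv
    (by nlinarith) t fun s hs => hloss s (by omega)
  have hexp := exp_neg_le_of_log_le hγ0 hγ1 ((le_max_right _ _).trans hη)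
  have hgeom := geom_sum_exp_neg_le (by positivity : 0 < γ ^ 2 / 16) t
  have hdrift : Real.exp (-(γ ^ 2 * η / 2))
      * ∑ s ∈ Finset.range t, Real.exp (-(γ ^ 2 / 16)) ^ s ≤ γ ^ 2 / 2 := by
    refine (mul_le_mul hexp hgeom (by positivity) (by positivity)).trans ?_
    have e : (γ ^ 2 / 256) ^ 2 * ((1 + γ ^ 2 / 16) / (γ ^ 2 / 16))
        = γ ^ 2 * (16 + γ ^ 2) / 65536 := by
      field_simp
      norm_num
    rw [e]
    have : γ ^ 2 < 1 := by nlinarith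
    nlinarith [sq_nonneg γ]
  linarith [mul_le_mul_of_nonneg_left hdrift hη0.le]
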